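/- Let f : X₁ × ⋯ × X_k → {0,1} be a weak graph function and suppose f⁻¹(1) can be partitioned into m star-free sets. Then there is a deterministic NOF communication protocol computing f with cost at most ⌈log₂ m⌉ + k bits; consequently log₂ χ(f) ≤ D(f) ≤ ⌈log₂ χ(f)⌉ + k, where χ(f) is the minimal number of monochromatic cylinder intersections partitioning f⁻¹(1). -/

import Mathlib

def IsCylinder {k : ℕ} {X : Fin k → Type*} (i : Fin k) (C : Set (∀ j, X j)) : Prop :=
  ∀ x y : ∀ j, X j, (∀ j, j ≠ i → x j = y j) → (x ∈ C ↔ y ∈ C)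

def IsCylinderIntersection {k : ℕ} {X : Fin k → Type*} (C : Set (∀ j, X j)) : Prop :=
  ∃ Cs : Fin k → Set (∀ j, X j), (∀ i, IsCylinder i (Cs i)) ∧ C = ⋂ i, Cs i

def ContainsStar {k : ℕ} {X : Fin k → Type*} (C : Set (∀ j, X j)) : Prop :=
  ∃ x x' : ∀ j, X j, ∀ i : Fin k, x' i ≠ x i ∧ Function.update x i (x' i) ∈ C

def IsWeakGraphFunction {k : ℕ} {X : Fin (k + 1) → Type*} (f : (∀ j, X j) → Bool) : Prop :=
  ∀ (x : ∀ j, X j) (y₁ y₂ : X (Fin.last k)),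
    f (Function.update x (Fin.last k) y₁) = true →
    f (Function.update x (Fin.last k) y₂) = true → y₁ = y₂

/-- A deterministic NOF protocol: at each node some player `i` writes a bit on the board,
depending only on the coordinates other than `i` (and, through the tree structure, on
the bits previously written). -/
inductive NOFProtocol {k : ℕ} (X : Fin k → Type*) : Type _ where
  | leaf : Bool → NOFProtocol X
  | node : (i : Fin k) → (msg : (∀ j, X j) → Bool) →
      (∀ x y : ∀ j, X j, (∀ j, j ≠ i → x j = y j) → msg x = msg y) →
      (Bool → NOFProtocol X) → NOFProtocol X

def NOFProtocol.eval {k : ℕ} {X : Fin k → Type*} : NOFProtocol X → (∀ j, X j) → Bool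
  | .leaf b, _ => b
  | .node _ msg _ next, x => (next (msg x)).eval x

/-- The cost of a protocol: the number of bits written on the worst input. -/
def NOFProtocol.cost {k : ℕ} {X : Fin k → Type*} : NOFProtocol X → ℕ
  | .leaf _ => 0
  | .node _ _ _ next => 1 + max (next true).cost (next false).cost

def NOFProtocol.Computes {k : ℕ} {X : Fin k → Type*} (p : NOFProtocol X)
    (f : (∀ j, X j) → Bool) : Prop :=
  ∀ x, p.eval x = f x

/-- Deterministic NOF communication complexity. -/
noncomputable def Dcc {k : ℕ} {X : Fin k → Type*} (f : (∀ j, X j) → Bool) : ℕ :=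
  sInf {c | ∃ p : NOFProtocol X, p.Computes f ∧ p.cost ≤ c}

/-- `χ(f)`: minimal number of monochromatic cylinder intersections partitioning
`f⁻¹(1)`. -/
noncomputable def chiCC {k : ℕ} {X : Fin k → Type*} (f : (∀ j, X j) → Bool) : ℕ :=
  sInf {m | ∃ F : Fin m → Set (∀ j, X j),
    (∀ j, IsCylinderIntersection (F j) ∧ F j ⊆ {x | f x = true}) ∧
    ∀ x, f x = true → ∃! j, x ∈ F j}

theorem aux_update_eq {k : ℕ} {X : Fin k → Type*} (i : Fin k) (x y : ∀ j, X j)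
    (h : ∀ j, j ≠ i → x j = y j) (a : X i) : Function.update x i a = Function.update y i a := by
  funext j
  by_cases hj : j = i
  · subst hj; simp
  · simp [hj, h j hj]

theorem aux_broadcast {k : ℕ} {X : Fin k → Type*} (i : Fin k) (d c : ℕ) :
    ∀ (g : (∀ j, X j) → ℕ)
      (_ : ∀ x y : ∀ j, X j, (∀ j, j ≠ i → x j = y j) → g x = g y)
      (_ : ∀ x, g x < 2 ^ c)
      (P : ℕ → NOFProtocol X) (_ : ∀ n, (P n).cost ≤ d),
      ∃ p : NOFProtocol X, p.cost ≤ c + d ∧ ∀ x, p.eval x = (P (g x)).eval x := by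
  induction c with
  | zero =>
    intro g _ hlt P hP
    refine ⟨P 0, by simpa using hP 0, fun x => ?_⟩
    have : g x = 0 := by have := hlt x; simp at this; exact this
    rw [this]
  | succ c ih =>
    intro g hg hlt P hP
    have key : ∀ b : Bool, ∃ p : NOFProtocol X, p.cost ≤ c + d ∧
        ∀ x, p.eval x = (P (2 * (g x / 2) + b.toNat)).eval x := by
      intro b
      refine ih (fun x => g x / 2) (fun x y h => by simp only [hg x y h]) (fun x => ?_)
        (fun n => P (2 * n + b.toNat)) (fun n => hP _)
      have := hlt x
      rw [pow_succ] at this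
      show g x / 2 < _
      omega
    choose q hq1 hq2 using key
    refine ⟨.node i (fun x => decide (g x % 2 = 1)) (fun x y h => by simp only [hg x y h]) q,
      ?_, fun x => ?_⟩
    · have h1 := hq1 true
      have h2 := hq1 false
      simp only [NOFProtocol.cost]
      omega
    · simp only [NOFProtocol.eval]
      rw [hq2]
      congr 2
      by_cases h : g x % 2 = 1
      · simp [h]; omega
      · simp [h]; omega

theorem aux_check {k : ℕ} {X : Fin k → Type*} (B : Fin k → (∀ j, X j) → Bool)
    (hB : ∀ i, ∀ x y : ∀ j, X j, (∀ j, j ≠ i → x j = y j) → B i x = B i y)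
    (L : List (Fin k)) :
    ∃ p : NOFProtocol X, p.cost ≤ L.length ∧ ∀ x, p.eval x = true ↔ ∀ i ∈ L, B i x = true := by
  induction L with
  | nil => exact ⟨.leaf true, by simp [NOFProtocol.cost], by simp [NOFProtocol.eval]⟩
  | cons i L ih =>
    obtain ⟨q, hq1, hq2⟩ := ih
    refine ⟨.node i (B i) (hB i) (fun b => if b then q else .leaf false), ?_, fun x => ?_⟩
    · simp only [NOFProtocol.cost, List.length_cons]
      simp [NOFProtocol.cost]
      omega
    · simp only [NOFProtocol.eval]
      cases h : B i x
      · simp [NOFProtocol.eval, h]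
      · simp [h, hq2]

theorem aux_protocol {k : ℕ} {X : Fin (k + 1) → Type*}
    (f : (∀ j, X j) → Bool) (hf : IsWeakGraphFunction f)
    (m : ℕ) (F : Fin m → Set (∀ j, X j))
    (hstarfree : ∀ j, ¬ ContainsStar (F j) ∧ F j ⊆ {x | f x = true})
    (hcover : ∀ x, f x = true → ∃! j, x ∈ F j) :
    ∃ p : NOFProtocol X, p.Computes f ∧ p.cost ≤ Nat.clog 2 m + (k + 1) := by
  classical
  let Q : Fin (k + 1) → ℕ → (∀ j, X j) → Prop := fun i n x =>
    ∃ h : n < m, ∃ y, Function.update x i y ∈ F ⟨n, h⟩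
  have hQ : ∀ i n, ∀ x y : ∀ j, X j, (∀ j, j ≠ i → x j = y j) → Q i n x = Q i n y := by
    intro i n x y h
    simp only [Q, aux_update_eq i x y h]
  have hchk : ∀ n : ℕ, ∃ p : NOFProtocol X, p.cost ≤ k + 1 ∧
      ∀ x, p.eval x = true ↔ ∀ i, Q i n x := by
    intro n
    obtain ⟨p, h1, h2⟩ := aux_check (fun i x => decide (Q i n x))
      (fun i x y h => by simp only [hQ i n x y h]) (List.finRange (k + 1))
    exact ⟨p, by simpa using h1, fun x => by simpa using h2 x⟩
  choose P hP1 hP2 using hchk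
  obtain ⟨p, hp1, hp2⟩ := aux_broadcast (Fin.last k) (k + 1) (Nat.clog 2 m)
    (fun x => sInf {n | Q (Fin.last k) n x})
    (fun x y h => by simp only [hQ _ _ x y h])
    (fun x => by
      show sInf {n | Q (Fin.last k) n x} < _
      rcases Set.eq_empty_or_nonempty {n | Q (Fin.last k) n x} with h | h
      · rw [h]; simp
      · obtain ⟨h1, _⟩ := Nat.sInf_mem h
        exact lt_of_lt_of_le h1 (Nat.le_pow_clog (by norm_num) m))
    P hP1
  refine ⟨p, fun x => ?_, hp1⟩
  rw [Bool.eq_iff_iff, hp2, hP2]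
  constructor
  · intro h
    obtain ⟨hlt, -⟩ := h 0
    by_contra hx
    choose h1 x' hx' using h
    refine (hstarfree ⟨_, hlt⟩).1 ⟨x, x', fun i => ⟨fun he => hx ?_, hx' i⟩⟩
    have := hx' i
    rw [he, Function.update_eq_self] at this
    exact (hstarfree _).2 this
  · intro hx
    obtain ⟨j, hj, -⟩ := hcover x hx
    have hne : {n | Q (Fin.last k) n x}.Nonempty :=
      ⟨j, j.2, x (Fin.last k), by rw [Function.update_eq_self]; exact hj⟩
    obtain ⟨h1, y, hy⟩ := Nat.sInf_mem hne
    have hyx : y = x (Fin.last k) :=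
      hf x y (x (Fin.last k)) ((hstarfree _).2 hy) (by rw [Function.update_eq_self]; exact hx)
    rw [hyx, Function.update_eq_self] at hy
    intro i
    exact ⟨h1, x i, by rw [Function.update_eq_self]; exact hy⟩

theorem aux_cyl_of_starfree {k : ℕ} {X : Fin k → Type*} (C : Set (∀ j, X j))
    (h : ¬ ContainsStar C) (hk : 0 < k) : IsCylinderIntersection C := by
  refine ⟨fun i => {x | ∃ y, Function.update x i y ∈ C}, fun i x y hxy => ?_, ?_⟩
  · simp only [Set.mem_setOf_eq, aux_update_eq i x y hxy]
  · ext x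
    simp only [Set.mem_iInter, Set.mem_setOf_eq]
    constructor
    · intro hx i
      exact ⟨x i, by rwa [Function.update_eq_self]⟩
    · intro hx
      by_contra hC
      choose x' hx' using hx
      refine h ⟨x, x', fun i => ⟨fun he => hC ?_, hx' i⟩⟩
      have := hx' i
      rwa [he, Function.update_eq_self] at this

theorem aux_starfree_of_cyl {k : ℕ} {X : Fin (k + 1) → Type*}
    (f : (∀ j, X j) → Bool) (hf : IsWeakGraphFunction f) (C : Set (∀ j, X j))
    (hC : IsCylinderIntersection C) (hCf : C ⊆ {x | f x = true}) : ¬ ContainsStar C := by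
  rintro ⟨x, x', h⟩
  obtain ⟨Cs, hCs, rfl⟩ := hC
  have hx : x ∈ ⋂ i, Cs i := by
    rw [Set.mem_iInter]
    intro i
    refine (hCs i (Function.update x i (x' i)) x (fun j hj => by simp [hj])).1 ?_
    exact Set.mem_iInter.1 (h i).2 i
  refine (h (Fin.last k)).1 (hf x _ _ (hCf (h (Fin.last k)).2) ?_)
  rw [Function.update_eq_self]
  exact hCf hx

theorem aux_cyl_inter {k : ℕ} {X : Fin k → Type*} (i : Fin k) (C D : Set (∀ j, X j))
    (hC : IsCylinderIntersection C) (hD : IsCylinder i D) : IsCylinderIntersection (C ∩ D) := by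
  obtain ⟨Cs, hCs, rfl⟩ := hC
  refine ⟨fun j => {x | x ∈ Cs j ∧ (j = i → x ∈ D)}, fun j x y h => ?_, ?_⟩
  · simp only [Set.mem_setOf_eq]
    rw [hCs j x y h]
    refine and_congr_right fun _ => ?_
    refine imp_congr_right fun hj => ?_
    subst hj
    exact hD x y h
  · ext x
    simp only [Set.mem_inter_iff, Set.mem_iInter, Set.mem_setOf_eq]
    constructor
    · exact fun h j => ⟨h.1 j, fun _ => h.2⟩
    · exact fun h => ⟨fun j => (h j).1, (h i).2 rfl⟩

theorem aux_leaves {k : ℕ} {X : Fin k → Type*} (p : NOFProtocol X) :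
    ∃ n : ℕ, n ≤ 2 ^ p.cost ∧ ∃ F : Fin n → Set (∀ j, X j),
      (∀ j, IsCylinderIntersection (F j) ∧ F j ⊆ {x | p.eval x = true}) ∧
      ∀ x, p.eval x = true → ∃! j, x ∈ F j := by
  induction p with
  | leaf b =>
    cases b
    · exact ⟨0, by simp, fun _ => ∅, fun j => j.elim0, by simp [NOFProtocol.eval]⟩
    · refine ⟨1, by simp [NOFProtocol.cost], fun _ => Set.univ, fun j => ⟨⟨fun _ => Set.univ,
        fun i x y _ => by simp, by simp⟩, by simp [NOFProtocol.eval]⟩, fun x _ => ⟨0, by simp, ?_⟩⟩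
      intro y _
      exact Subsingleton.elim _ _
  | node i msg hmsg next ih =>
    choose n hn F hF1 hF2 using ih
    let e := @finSumFinEquiv (n true) (n false)
    let G : Fin (n true) ⊕ Fin (n false) → Set (∀ j, X j) :=
      Sum.elim (fun j => F true j ∩ {x | msg x = true}) (fun j => F false j ∩ {x | msg x = false})
    have hcyl : ∀ b, IsCylinder i {x | msg x = b} := fun b x y h => by
      simp only [Set.mem_setOf_eq, hmsg x y h]
    have hG1 : ∀ s, IsCylinderIntersection (G s) ∧
        G s ⊆ {x | (NOFProtocol.node i msg hmsg next).eval x = true} := by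
      rintro (j | j)
      · refine ⟨aux_cyl_inter i _ _ (hF1 true j).1 (hcyl true), ?_⟩
        rintro x ⟨h1, h2⟩
        simp only [Set.mem_setOf_eq] at h2
        simp only [NOFProtocol.eval, Set.mem_setOf_eq, h2]
        exact (hF1 true j).2 h1
      · refine ⟨aux_cyl_inter i _ _ (hF1 false j).1 (hcyl false), ?_⟩
        rintro x ⟨h1, h2⟩
        simp only [Set.mem_setOf_eq] at h2
        simp only [NOFProtocol.eval, Set.mem_setOf_eq, h2]
        exact (hF1 false j).2 h1
    have hG2 : ∀ x, (NOFProtocol.node i msg hmsg next).eval x = true → ∃! s, x ∈ G s := by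
      intro x hx
      simp only [NOFProtocol.eval] at hx
      cases hm : msg x
      · rw [hm] at hx
        obtain ⟨j, hj, hu⟩ := hF2 false x hx
        refine ⟨.inr j, ⟨hj, hm⟩, ?_⟩
        rintro (j' | j') ⟨h1, h2⟩
        · simp [hm] at h2
        · exact congrArg _ (hu j' h1)
      · rw [hm] at hx
        obtain ⟨j, hj, hu⟩ := hF2 true x hx
        refine ⟨.inl j, ⟨hj, hm⟩, ?_⟩
        rintro (j' | j') ⟨h1, h2⟩
        · exact congrArg _ (hu j' h1)
        · simp [hm] at h2
    refine ⟨n true + n false, ?_, fun j => G (e.symm j), fun j => hG1 _, fun x hx => ?_⟩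
    · simp only [NOFProtocol.cost]
      have h1 := (hn true).trans (Nat.pow_le_pow_right (n := 2) (by norm_num)
        (le_max_left (next true).cost (next false).cost))
      have h2 := (hn false).trans (Nat.pow_le_pow_right (n := 2) (by norm_num)
        (le_max_right (next true).cost (next false).cost))
      rw [pow_add]
      omega
    · obtain ⟨s, hs, hu⟩ := hG2 x hx
      refine ⟨e s, by simpa using hs, fun j hj => ?_⟩
      rw [← hu _ hj, Equiv.apply_symm_apply]

/-- Let `f` be a weak graph function on `k+1` coordinates (i.e. `k+1` players) whose
`1`-set is partitioned into `m` star-free sets. Then there is a deterministic NOF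
protocol computing `f` of cost at most `⌈log₂ m⌉ + (k+1)`; consequently
`log₂ χ(f) ≤ D(f) ≤ ⌈log₂ χ(f)⌉ + (k+1)`. -/
theorem protocol_from_starfree_partition {k : ℕ} {X : Fin (k + 1) → Type*}
    [∀ j, Fintype (X j)] (f : (∀ j, X j) → Bool) (hf : IsWeakGraphFunction f)
    (m : ℕ) (F : Fin m → Set (∀ j, X j))
    (hstarfree : ∀ j, ¬ ContainsStar (F j) ∧ F j ⊆ {x | f x = true})
    (hcover : ∀ x, f x = true → ∃! j, x ∈ F j) :
    (∃ p : NOFProtocol X, p.Computes f ∧ p.cost ≤ Nat.clog 2 m + (k + 1)) ∧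
    Nat.log 2 (chiCC f) ≤ Dcc f ∧ Dcc f ≤ Nat.clog 2 (chiCC f) + (k + 1) := by
  have h1 := aux_protocol f hf m F hstarfree hcover
  refine ⟨h1, ?_, ?_⟩
  · have hne : {c | ∃ p : NOFProtocol X, p.Computes f ∧ p.cost ≤ c}.Nonempty := ⟨_, h1⟩
    obtain ⟨p, hp, hc⟩ : ∃ p : NOFProtocol X, p.Computes f ∧ p.cost ≤ Dcc f := Nat.sInf_mem hne
    obtain ⟨n, hn, G, hG1, hG2⟩ := aux_leaves p
    have hchi : chiCC f ≤ n := by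
      apply Nat.sInf_le
      refine ⟨G, fun j => ⟨(hG1 j).1, fun x hx => ?_⟩, fun x hx => hG2 x ((hp x).trans hx)⟩
      exact (hp x).symm.trans ((hG1 j).2 hx)
    calc Nat.log 2 (chiCC f) ≤ Nat.log 2 (2 ^ p.cost) := Nat.log_mono_right (hchi.trans hn)
      _ = p.cost := Nat.log_pow (by norm_num) _
      _ ≤ Dcc f := hc
  · have hne : {m | ∃ F : Fin m → Set (∀ j, X j),
        (∀ j, IsCylinderIntersection (F j) ∧ F j ⊆ {x | f x = true}) ∧
        ∀ x, f x = true → ∃! j, x ∈ F j}.Nonempty :=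
      ⟨m, F, fun j => ⟨aux_cyl_of_starfree _ (hstarfree j).1 (Nat.succ_pos k),
        (hstarfree j).2⟩, hcover⟩
    obtain ⟨G, hG1, hG2⟩ := Nat.sInf_mem hne
    exact Nat.sInf_le (aux_protocol f hf (chiCC f) G
      (fun j => ⟨aux_starfree_of_cyl f hf _ (hG1 j).1 (hG1 j).2, (hG1 j).2⟩) hG2)
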